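/- arXiv:1109.3956 — 3 statements merged into one kernel-verified Lean document; each statement's English description precedes it below -/
import Mathlib

section
/- Let z be an element of the graded center Z_gr(E(Γ_q)) that is homogeneous both with respect to path length and with respect to the (a,c ↦ +1, b ↦ −1)-degree. Then either z is a scalar in k, or there exist integers s₀ ≥ 0 and t₀ ≥ 1 with s₀ ≡ t₀ (mod m) and scalars u₀,…,u_{m−1} ∈ k such that z = Σ_{i=0}^{m−1} u_i γ_i^{s₀} δ_i^{t₀}, where for all 0 ≤ j ≤ m−1 (subscripts of u and q taken mod m, u_m = u₀): u_{j+1} = (−1)^{s₀}(q_{j+1}q_{j+2}⋯q_{j+t₀})^{−1} u_j = (−1)^{t₀}(q_{j+1}q_{j+2}⋯q_{j+s₀})^{−1} u_j. -/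
/-- Generators of the path algebra of the quiver `Q'`: idempotents `e v` for the vertices
(`some i` for `0 ≤ i ≤ m−1`, `none` for the extra vertex `−1`), and arrows
`a i : i → i+1`, `b i : i+1 → i`, `c i : i → −1`. -/
inductive GenA (m : ℕ) : Type
  | e : Option (ZMod m) → GenA m
  | a : ZMod m → GenA m
  | b : ZMod m → GenA m
  | c : ZMod m → GenA m

variable (k : Type) [Field k] (m : ℕ) [NeZero m] (q : ZMod m → k)

open FreeAlgebra in
/-- Relations presenting the Koszul dual `E(Γ_q)` as a quotient of the free algebra on the
generators: the path-algebra relations for the quiver `Q'` together with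
`q_i⁻¹ a_i b_i + b_{i−1} a_{i−1} = 0` and `b_i c_i = 0` (paths composed left to right). -/
inductive ERel : FreeAlgebra k (GenA m) → FreeAlgebra k (GenA m) → Prop
  | vert (v w : Option (ZMod m)) :
      ERel (ι k (GenA.e v) * ι k (GenA.e w)) (if v = w then ι k (GenA.e v) else 0)
  | unit : ERel (∑ v : Option (ZMod m), ι k (GenA.e v)) 1
  | srcA (i : ZMod m) : ERel (ι k (GenA.e (some i)) * ι k (GenA.a i)) (ι k (GenA.a i))
  | tgtA (i : ZMod m) : ERel (ι k (GenA.a i) * ι k (GenA.e (some (i+1)))) (ι k (GenA.a i))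
  | srcB (i : ZMod m) : ERel (ι k (GenA.e (some (i+1))) * ι k (GenA.b i)) (ι k (GenA.b i))
  | tgtB (i : ZMod m) : ERel (ι k (GenA.b i) * ι k (GenA.e (some i))) (ι k (GenA.b i))
  | srcC (i : ZMod m) : ERel (ι k (GenA.e (some i)) * ι k (GenA.c i)) (ι k (GenA.c i))
  | tgtC (i : ZMod m) : ERel (ι k (GenA.c i) * ι k (GenA.e none)) (ι k (GenA.c i))
  | relAB (i : ZMod m) :
      ERel ((q i)⁻¹ • (ι k (GenA.a i) * ι k (GenA.b i)) +
        ι k (GenA.b (i-1)) * ι k (GenA.a (i-1))) 0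
  | relBC (i : ZMod m) : ERel (ι k (GenA.b i) * ι k (GenA.c i)) 0

/-- The Koszul dual `E(Γ_q)`. -/
abbrev EΓ : Type := RingQuot (ERel k m q)

/-- The image of a generator in `E(Γ_q)`. -/
noncomputable def gE (g : GenA m) : EΓ k m q :=
  RingQuot.mkAlgHom k (ERel k m q) (FreeAlgebra.ι k g)

/-- Arrows, labelled by `Fin 3`: `0 ↦ a i`, `1 ↦ b i`, `2 ↦ c i`. -/
def arrA (p : ZMod m × Fin 3) : GenA m :=
  if p.2 = 0 then GenA.a p.1 else if p.2 = 1 then GenA.b p.1 else GenA.c p.1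

/-- The length-`l` homogeneous component of `E(Γ_q)` (the span of the paths of length `l`). -/
noncomputable def HboxA (l : ℕ) : Submodule k (EΓ k m q) :=
  Submodule.span k
    {x | ∃ (v : Option (ZMod m)) (L : List (ZMod m × Fin 3)), L.length = l ∧
      x = gE k m q (GenA.e v) * (L.map fun p => gE k m q (arrA m p)).prod}

/-- The graded centre `Z_gr(E(Γ_q))`: the subalgebra generated (equivalently, spanned) by the
length-homogeneous elements `z` with `z y = (−1)^{|z||y|} y z` for all length-homogeneous `y`. -/
noncomputable def ZgrA : Subalgebra k (EΓ k m q) :=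
  Algebra.adjoin k
    {z | ∃ l : ℕ, z ∈ HboxA k m q l ∧
      ∀ (l' : ℕ) (y : EΓ k m q), y ∈ HboxA k m q l' →
        z * y = ((-1 : k) ^ (l * l')) • (y * z)}

/-- The degree of an arrow: `a` and `c` have degree `+1`, `b` has degree `−1`. -/
def degA (t : Fin 3) : ℤ := if t = 1 then -1 else 1

/-- The component of `E(Γ_q)` consisting of elements homogeneous of length `l` and of degree
`d` (for the grading with `deg a_i = deg c_i = 1`, `deg b_i = −1`). -/
noncomputable def HDboxA (k : Type) [Field k] (m : ℕ) [NeZero m] (q : ZMod m → k)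
    (l : ℕ) (d : ℤ) : Submodule k (EΓ k m q) :=
  Submodule.span k
    {x | ∃ (v : Option (ZMod m)) (L : List (ZMod m × Fin 3)), L.length = l ∧
      (L.map fun p => degA p.2).sum = d ∧
      x = gE k m q (GenA.e v) * (L.map fun p => gE k m q (arrA m p)).prod}

/-- `γ_i^s = a_i a_{i+1} ⋯ a_{i+s−1}`. -/
noncomputable def γA (k : Type) [Field k] (m : ℕ) [NeZero m] (q : ZMod m → k)
    (i : ZMod m) (s : ℕ) : EΓ k m q :=
  ((List.range s).map fun t => gE k m q (GenA.a (i + (t : ZMod m)))).prod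

/-- `δ_i^t = b_{i+t−1} ⋯ b_{i+1} b_i`. -/
noncomputable def δA (k : Type) [Field k] (m : ℕ) [NeZero m] (q : ZMod m → k)
    (i : ZMod m) (t : ℕ) : EΓ k m q :=
  ((List.range t).reverse.map fun l => gE k m q (GenA.b (i + (l : ZMod m)))).prod

set_option linter.unusedSectionVars false

namespace KoszulDual

/-- Indices for the normal-form basis of `E(Γ_q)`: the trivial path at `−1`, the paths
`γ_i^s δ_{i+s-t}^t`, and the paths `γ_i^s c_{i+s}`. -/
inductive Word (m : ℕ) : Type
  | nil : Word m
  | ab : ZMod m → ℕ → ℕ → Word m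
  | ac : ZMod m → ℕ → Word m
  deriving DecidableEq

variable {k m} in
/-- The scalar such that `b_j γ_j^s` is this multiple of `γ_{j+1}^s b_{j+s}`. -/
def swapCoeff (j : ZMod m) (s : ℕ) : k :=
  ∏ r ∈ Finset.range s, -(q (j + 1 + (r : ZMod m)))⁻¹

/-- Left multiplication of a normal path by a generator. -/
noncomputable def leftGen : GenA m → Word m → (Word m →₀ k)
  | .e none, .nil => .single .nil 1
  | .e (some v), .ab i s t => if i = v then .single (.ab i s t) 1 else 0
  | .e (some v), .ac i s => if i = v then .single (.ac i s) 1 else 0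
  | .a j, .ab i s t => if i = j + 1 then .single (.ab j (s + 1) t) 1 else 0
  | .a j, .ac i s => if i = j + 1 then .single (.ac j (s + 1)) 1 else 0
  | .b j, .ab i s t => if i = j then .single (.ab (j + 1) s (t + 1)) (swapCoeff q j s) else 0
  | .c j, .nil => .single (.ac j 0) 1
  | _, _ => 0

/-- Right multiplication of a normal path by a generator. -/
noncomputable def rightGen : GenA m → Word m → (Word m →₀ k)
  | .e none, .nil => .single .nil 1
  | .e none, .ac i s => .single (.ac i s) 1
  | .e (some v), .ab i s t => if i + s - t = v then .single (.ab i s t) 1 else 0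
  | .a j, .ab i s t => if i + s - t = j then .single (.ab i (s + 1) t) (swapCoeff q j t) else 0
  | .b j, .ab i s t => if i + s - t = j + 1 then .single (.ab i s (t + 1)) 1 else 0
  | .c j, .ab i s 0 => if i + s = j then .single (.ac i s) 1 else 0
  | _, _ => 0

/-- Left multiplication by a generator as an operator on the span of the normal paths. -/
noncomputable def leftOp (g : GenA m) : Module.End k (Word m →₀ k) :=
  Finsupp.linearCombination k (leftGen k m q g)

/-- Right multiplication by a generator as an operator on the span of the normal paths. -/
noncomputable def rightOp (g : GenA m) : Module.End k (Word m →₀ k) :=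
  Finsupp.linearCombination k (rightGen k m q g)

theorem swapCoeff_zero (j : ZMod m) : swapCoeff q j 0 = 1 := by simp [swapCoeff]

theorem swapCoeff_succ (j : ZMod m) (s : ℕ) :
    swapCoeff q j (s + 1) = swapCoeff q j s * -(q (j + 1 + (s : ZMod m)))⁻¹ := by
  simp [swapCoeff, Finset.prod_range_succ]

theorem swapCoeff_succ' (j : ZMod m) (s : ℕ) :
    swapCoeff q j (s + 1) = -(q (j + 1))⁻¹ * swapCoeff q (j + 1) s := by
  simp only [swapCoeff, Finset.prod_range_succ', Nat.cast_zero, add_zero, mul_comm]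
  congr 1
  refine Finset.prod_congr rfl fun r _ => ?_
  push_cast
  ring_nf

theorem swapCoeff_eq (j : ZMod m) (s : ℕ) :
    swapCoeff q j s = (-1) ^ s * (∏ r ∈ Finset.range s, q (j + 1 + (r : ZMod m)))⁻¹ := by
  simp [swapCoeff, Finset.prod_neg]

theorem leftOp_rel (x y : FreeAlgebra k (GenA m)) (h : ERel k m q x y) :
    FreeAlgebra.lift k (leftOp k m q) x = FreeAlgebra.lift k (leftOp k m q) y := by
  induction h with
  | unit =>
    ext1 w
    ext1
    rcases w with _ | ⟨j, s, t⟩ | ⟨j, s⟩ <;> simp [leftOp, leftGen]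
  | vert v w =>
    ext1 x
    ext1
    rcases eq_or_ne v w with rfl | h
    · rcases v with _ | v <;> rcases x with _ | ⟨j, s, t⟩ | ⟨j, s⟩ <;>
        simp [leftOp, leftGen] <;> split_ifs <;> simp_all [leftGen]
    · rcases v with _ | v <;> rcases w with _ | w <;> rcases x with _ | ⟨j, s, t⟩ | ⟨j, s⟩ <;>
        simp [leftOp, leftGen, h] <;> split_ifs <;> simp_all [leftGen, eq_comm]
  | relAB i =>
    ext1 x
    ext1
    rcases x with _ | ⟨j, s, t⟩ | ⟨j, s⟩ <;> simp [leftOp, leftGen]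
    · by_cases h : j = i
      · subst h
        simp [leftGen, swapCoeff_succ', mul_comm]
      · simp [h]
    · split_ifs <;> simp [leftGen]
  | relBC i =>
    ext1 x
    ext1
    rcases x with _ | ⟨j, s, t⟩ | ⟨j, s⟩ <;> simp [leftOp, leftGen]
  | srcA i | tgtA i | srcB i | tgtB i | srcC i | tgtC i =>
    ext1 x
    ext1
    rcases x with _ | ⟨j, s, t⟩ | ⟨j, s⟩ <;> simp [leftOp, leftGen] <;>
      split_ifs <;> simp_all [leftGen]

/-- The left regular representation of `E(Γ_q)` in terms of normal paths. -/
noncomputable def rep : EΓ k m q →ₐ[k] Module.End k (Word m →₀ k) :=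
  RingQuot.liftAlgHom k ⟨FreeAlgebra.lift k (leftOp k m q), leftOp_rel k m q⟩

theorem rep_gE (g : GenA m) : rep k m q (gE k m q g) = leftOp k m q g := by
  simp [rep, gE]

theorem induction_gE {P : EΓ k m q → Prop} (hc : ∀ c : k, P (algebraMap k _ c))
    (hg : ∀ g, P (gE k m q g)) (hadd : ∀ x y, P x → P y → P (x + y))
    (hmul : ∀ x y, P x → P y → P (x * y)) (x : EΓ k m q) : P x := by
  obtain ⟨x, rfl⟩ := RingQuot.mkAlgHom_surjective k (ERel k m q) x
  induction x using FreeAlgebra.induction with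
  | grade0 r => simpa using hc r
  | grade1 g => exact hg g
  | mul x y hx hy => simpa using hmul _ _ hx hy
  | add x y hx hy => simpa using hadd _ _ hx hy

set_option maxHeartbeats 2000000 in
theorem leftOp_comm_rightOp (g h : GenA m) : Commute (leftOp k m q g) (rightOp k m q h) := by
  have h₁ (x y z : ZMod m) : x + 1 + y - (z + 1) = x + y - z := by ring
  have h₂ (x y : ZMod m) : x + 1 + y - 1 = x + y := by ring
  have h₃ (x y : ZMod m) : x + (y + 1) = x + 1 + y := by ring
  refine Finsupp.lhom_ext' fun x => ?_
  ext1
  rcases g with (_ | v) | j | j | j <;> rcases h with (_ | w) | j' | j' | j' <;>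
    rcases x with _ | ⟨i, s, _ | t⟩ | ⟨i, s⟩ <;>
    simp [leftOp, rightOp, leftGen, rightGen] <;>
    (try split_ifs) <;> (try subst_vars) <;>
    simp_all [leftGen, rightGen]
  · rw [← Finsupp.single_mul, ← Finsupp.single_mul, swapCoeff_succ, swapCoeff_succ]
    simp [swapCoeff_zero, add_right_comm]
  · rw [← Finsupp.single_mul, ← Finsupp.single_mul, swapCoeff_succ k m q i, swapCoeff_succ k m q _ (t + 1),
      show i + s - (t + 1) + 1 + ((t + 1 : ℕ) : ZMod m) = i + 1 + s by push_cast; ring]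
    congr 1
    ring

/-- The vector of normal paths representing `1`. -/
noncomputable def oneVec : Word m →₀ k :=
  .single .nil 1 + ∑ i : ZMod m, .single (.ab i 0 0) 1

theorem leftOp_oneVec (g : GenA m) :
    leftOp k m q g (oneVec k m) = rightOp k m q g (oneVec k m) := by
  rcases g with (_ | v) | j | j | j <;> simp [oneVec, leftOp, rightOp, leftGen, rightGen, swapCoeff_zero]

/-- The coordinates of an element of `E(Γ_q)` with respect to the normal paths. -/
noncomputable def coords : EΓ k m q →ₗ[k] (Word m →₀ k) :=
  (LinearMap.applyₗ (oneVec k m)).comp (rep k m q).toLinearMap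

theorem coords_apply (x : EΓ k m q) : coords k m q x = rep k m q x (oneVec k m) := rfl

theorem coords_gE_mul (g : GenA m) (x : EΓ k m q) :
    coords k m q (gE k m q g * x) = leftOp k m q g (coords k m q x) := by
  simp [coords_apply, rep_gE]

theorem rep_comm_rightOp (x : EΓ k m q) (g : GenA m) :
    Commute (rep k m q x) (rightOp k m q g) := by
  induction x using induction_gE with
  | hc c => simpa using Algebra.commute_algebraMap_left _ _
  | hg h => simpa [rep_gE] using leftOp_comm_rightOp k m q h g
  | hadd x y hx hy => simpa using hx.add_left hy
  | hmul x y hx hy => simpa using hx.mul_left hy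

theorem coords_mul_gE (g : GenA m) (x : EΓ k m q) :
    coords k m q (x * gE k m q g) = rightOp k m q g (coords k m q x) := by
  have := LinearMap.congr_fun (rep_comm_rightOp k m q x g).eq (oneVec k m)
  simpa [coords_apply, rep_gE, leftOp_oneVec] using this

section Span

/-- The element of `E(Γ_q)` represented by a normal path. -/
noncomputable def Word.eval : Word m → EΓ k m q
  | .nil => gE k m q (.e none)
  | .ab i s t => gE k m q (.e (some i)) * (γA k m q i s * δA k m q (i + s - t) t)
  | .ac i s => gE k m q (.e (some i)) * (γA k m q i s * gE k m q (.c (i + s)))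

theorem γA_succ (i : ZMod m) (s : ℕ) :
    γA k m q i (s + 1) = gE k m q (.a i) * γA k m q (i + 1) s := by
  simp [γA, -List.pure_def, -List.bind_eq_flatMap, bind_pure_comp, List.range_succ_eq_map,
    Function.comp_def, add_assoc, add_comm (1 : ZMod m)]

theorem δA_succ (i : ZMod m) (t : ℕ) :
    δA k m q i (t + 1) = gE k m q (.b (i + t)) * δA k m q i t := by
  simp [δA, List.range_succ]

theorem gE_e_mul_e (v w : Option (ZMod m)) :
    gE k m q (.e v) * gE k m q (.e w) = if v = w then gE k m q (.e v) else 0 := by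
  have := RingQuot.mkAlgHom_rel k (ERel.vert (k := k) (q := q) v w)
  simpa [gE, apply_ite] using this

theorem gE_e_mul_a (i : ZMod m) :
    gE k m q (.e (some i)) * gE k m q (.a i) = gE k m q (.a i) := by
  simpa [gE] using RingQuot.mkAlgHom_rel k (ERel.srcA (k := k) (q := q) i)

theorem gE_a_mul_e (i : ZMod m) :
    gE k m q (.a i) * gE k m q (.e (some (i + 1))) = gE k m q (.a i) := by
  simpa [gE] using RingQuot.mkAlgHom_rel k (ERel.tgtA (k := k) (q := q) i)

theorem gE_e_mul_b (i : ZMod m) :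
    gE k m q (.e (some (i + 1))) * gE k m q (.b i) = gE k m q (.b i) := by
  simpa [gE] using RingQuot.mkAlgHom_rel k (ERel.srcB (k := k) (q := q) i)

theorem gE_b_mul_e (i : ZMod m) :
    gE k m q (.b i) * gE k m q (.e (some i)) = gE k m q (.b i) := by
  simpa [gE] using RingQuot.mkAlgHom_rel k (ERel.tgtB (k := k) (q := q) i)

theorem gE_e_mul_c (i : ZMod m) :
    gE k m q (.e (some i)) * gE k m q (.c i) = gE k m q (.c i) := by
  simpa [gE] using RingQuot.mkAlgHom_rel k (ERel.srcC (k := k) (q := q) i)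

theorem gE_c_mul_e (i : ZMod m) :
    gE k m q (.c i) * gE k m q (.e none) = gE k m q (.c i) := by
  simpa [gE] using RingQuot.mkAlgHom_rel k (ERel.tgtC (k := k) (q := q) i)

theorem gE_b_mul_c (i : ZMod m) : gE k m q (.b i) * gE k m q (.c i) = 0 := by
  simpa [gE] using RingQuot.mkAlgHom_rel k (ERel.relBC (k := k) (q := q) i)

theorem gE_b_mul_a (i : ZMod m) :
    gE k m q (.b i) * gE k m q (.a i) =
      (-(q (i + 1))⁻¹) • (gE k m q (.a (i + 1)) * gE k m q (.b (i + 1))) := by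
  have := RingQuot.mkAlgHom_rel k (ERel.relAB (k := k) (q := q) (i + 1))
  simp only [map_add, map_smul, map_mul, map_zero, add_sub_cancel_right] at this
  exact (eq_neg_of_add_eq_zero_right this).trans (neg_smul (M := EΓ k m q) _ _).symm

theorem sum_gE_e : ∑ v : Option (ZMod m), gE k m q (.e v) = 1 := by
  simpa only [gE, map_sum, map_one] using RingQuot.mkAlgHom_rel k (ERel.unit (k := k) (q := q))

theorem gE_b_mul_γA (j : ZMod m) (s : ℕ) :
    gE k m q (.b j) * γA k m q j s =
      swapCoeff q j s • (γA k m q (j + 1) s * gE k m q (.b (j + s))) := by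
  induction s generalizing j with
  | zero => simp [γA, swapCoeff_zero]
  | succ s ih =>
    rw [γA_succ, ← mul_assoc, gE_b_mul_a, smul_mul_assoc, mul_assoc, ih, mul_smul_comm, smul_smul,
      swapCoeff_succ', γA_succ, mul_assoc]
    push_cast
    rw [add_comm (s : ZMod m) 1, ← add_assoc]

theorem mul_e_of_mul_e {x y : EΓ k m q} {v : Option (ZMod m)}
    (hx : x * gE k m q (.e v) = x) (w : Option (ZMod m)) :
    x * (gE k m q (.e w) * y) = if w = v then x * y else 0 := by
  conv_lhs => rw [← hx]
  rw [mul_assoc, ← mul_assoc (gE k m q (.e v)), gE_e_mul_e]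
  by_cases h : w = v
  · simp [h, ← mul_assoc, hx]
  · simp [h, Ne.symm h]

theorem gE_e_mul_γA_mul {i : ZMod m} {y : EΓ k m q} (s : ℕ)
    (hy : gE k m q (.e (some (i + s))) * y = y) :
    gE k m q (.e (some i)) * (γA k m q i s * y) = γA k m q i s * y := by
  cases s with
  | zero => simpa [γA] using hy
  | succ s => rw [γA_succ, mul_assoc, ← mul_assoc, gE_e_mul_a]

theorem Word.gE_mul_eval (g : GenA m) (x : Word m) :
    gE k m q g * x.eval k m q =
      Finsupp.linearCombination k (Word.eval k m q) (leftGen k m q g x) := by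
  rcases g with v | j | j | j
  · rcases v with _ | v <;> rcases x with _ | ⟨i, s, t⟩ | ⟨i, s⟩ <;>
      simp only [Word.eval, ← mul_assoc, gE_e_mul_e, leftGen] <;>
      split_ifs <;> simp_all [Word.eval, mul_assoc]
  · rcases x with _ | ⟨i, s, t⟩ | ⟨i, s⟩
    · simpa [Word.eval, leftGen] using
        mul_e_of_mul_e k m q (y := 1) (gE_a_mul_e k m q j) none
    · rw [Word.eval, mul_e_of_mul_e k m q (gE_a_mul_e k m q j), leftGen]
      by_cases h : i = j + 1
      · subst h
        simp [Word.eval, γA_succ, ← mul_assoc, gE_e_mul_a, add_assoc, add_comm (1 : ZMod m)]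
      · simp [h]
    · rw [Word.eval, mul_e_of_mul_e k m q (gE_a_mul_e k m q j), leftGen]
      by_cases h : i = j + 1
      · subst h
        simp [Word.eval, γA_succ, ← mul_assoc, gE_e_mul_a, add_assoc, add_comm (1 : ZMod m)]
      · simp [h]
  · rcases x with _ | ⟨i, s, t⟩ | ⟨i, s⟩
    · simpa [Word.eval, leftGen] using
        mul_e_of_mul_e k m q (y := 1) (gE_b_mul_e k m q j) none
    · rw [Word.eval, mul_e_of_mul_e k m q (gE_b_mul_e k m q j), leftGen]
      by_cases h : i = j
      · subst h
        have hb : gE k m q (.e (some (i + 1 + s))) * (gE k m q (.b (i + s)) *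
            δA k m q (i + s - t) t) = gE k m q (.b (i + s)) * δA k m q (i + s - t) t := by
          rw [← mul_assoc, add_right_comm, gE_e_mul_b]
        simp only [if_true, Finsupp.linearCombination_single, Word.eval, Nat.cast_add,
          Nat.cast_one, add_right_comm i 1, add_sub_add_right_eq_sub, δA_succ, sub_add_cancel]
        rw [← mul_assoc, gE_b_mul_γA, smul_mul_assoc, mul_assoc, gE_e_mul_γA_mul k m q s hb]
      · simp [h]
    · rw [Word.eval, mul_e_of_mul_e k m q (gE_b_mul_e k m q j), leftGen]
      by_cases h : i = j
      · subst h
        simp [← mul_assoc, gE_b_mul_γA]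
        simp [mul_assoc, gE_b_mul_c]
      · simp [h]
      all_goals simp
  · rcases x with _ | ⟨i, s, t⟩ | ⟨i, s⟩
    · simpa [Word.eval, leftGen, γA, gE_e_mul_c] using gE_c_mul_e k m q j
    · simpa [Word.eval, leftGen] using mul_e_of_mul_e k m q (gE_c_mul_e k m q j) (some i)
    · simpa [Word.eval, leftGen] using mul_e_of_mul_e k m q (gE_c_mul_e k m q j) (some i)

/-- The element of `E(Γ_q)` with given coordinates. -/
noncomputable def ofCoords : (Word m →₀ k) →ₗ[k] EΓ k m q :=
  Finsupp.linearCombination k (Word.eval k m q)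

theorem ofCoords_leftOp (g : GenA m) (f : Word m →₀ k) :
    ofCoords k m q (leftOp k m q g f) = gE k m q g * ofCoords k m q f := by
  induction f using Finsupp.induction_linear with
  | zero => simp
  | add f f' h h' => simp [h, h', mul_add]
  | single x c => simp [ofCoords, leftOp, Word.gE_mul_eval]

theorem ofCoords_rep (x : EΓ k m q) (f : Word m →₀ k) :
    ofCoords k m q (rep k m q x f) = x * ofCoords k m q f := by
  induction x using induction_gE generalizing f with
  | hc c => simp [Algebra.smul_def]
  | hg g => rw [rep_gE, ofCoords_leftOp]
  | hadd x y hx hy => simp [hx, hy, add_mul]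
  | hmul x y hx hy => simp [hx, hy, mul_assoc]

theorem ofCoords_oneVec : ofCoords k m q (oneVec k m) = 1 := by
  rw [← sum_gE_e k m q]
  simp [oneVec, ofCoords, Word.eval, γA, δA]

theorem ofCoords_coords (x : EΓ k m q) : ofCoords k m q (coords k m q x) = x := by
  rw [coords_apply, ofCoords_rep, ofCoords_oneVec, mul_one]

end Span

section Grading

variable {M : Type} [AddCommMonoid M] (w : Fin 3 → M)

/-- The degree of a normal path when the arrows have the given weights. -/
def Word.deg : Word m → M
  | .nil => 0
  | .ab _ s t => s • w 0 + t • w 1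
  | .ac _ s => s • w 0 + w 2

/-- The vectors of coordinates that are homogeneous of degree `n`. -/
noncomputable def homComp (n : M) : Submodule k (Word m →₀ k) :=
  Finsupp.supported k k {x | x.deg m w = n}

variable {k m} in
theorem mem_homComp {n : M} {f : Word m →₀ k} :
    f ∈ homComp k m w n ↔ ∀ x, f x ≠ 0 → x.deg m w = n := by
  simp [homComp, Finsupp.mem_supported, Set.subset_def]

theorem single_mem_homComp {n : M} {x : Word m} (h : x.deg m w = n) (c : k) :
    Finsupp.single x c ∈ homComp k m w n :=
  Finsupp.single_mem_supported k c h

/-- The elements of `E(Γ_q)` whose left multiplication raises degrees by `n`. -/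
noncomputable def homElem (n : M) : Submodule k (EΓ k m q) where
  carrier := {x | ∀ n' f, f ∈ homComp k m w n' → rep k m q x f ∈ homComp k m w (n + n')}
  add_mem' hx hy n' f hf := by
    simpa using add_mem (hx n' f hf) (hy n' f hf)
  zero_mem' n' f hf := by simp
  smul_mem' c x hx n' f hf := by
    simpa using Submodule.smul_mem _ c (hx n' f hf)

variable {k m q w} in
theorem mul_mem_homElem {n n' : M} {x y : EΓ k m q} (hx : x ∈ homElem k m q w n)
    (hy : y ∈ homElem k m q w n') : x * y ∈ homElem k m q w (n + n') := by
  intro n₀ f hf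
  rw [map_mul, Module.End.mul_apply, add_assoc]
  exact hx _ _ (hy _ _ hf)

theorem one_mem_homElem : 1 ∈ homElem k m q w 0 := by
  intro n f hf
  simpa using hf

theorem gE_mem_homElem {g : GenA m} {n : M}
    (h : ∀ x : Word m, leftGen k m q g x ∈ homComp k m w (n + x.deg m w)) :
    gE k m q g ∈ homElem k m q w n := by
  intro n' f hf
  rw [rep_gE, leftOp, Finsupp.linearCombination_apply, Finsupp.sum]
  refine sum_mem fun x hx => Submodule.smul_mem _ _ ?_
  rw [← (mem_homComp w).1 hf x (Finsupp.mem_support_iff.1 hx)]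
  exact h x

theorem gE_e_mem_homElem (v : Option (ZMod m)) :
    gE k m q (.e v) ∈ homElem k m q w 0 := by
  refine gE_mem_homElem k m q w fun x => ?_
  rcases v with _ | v <;> rcases x with _ | ⟨i, s, t⟩ | ⟨i, s⟩ <;> simp only [leftGen] <;>
    (try split_ifs) <;>
    first
    | exact zero_mem _
    | exact single_mem_homComp k m w (zero_add _).symm _

theorem gE_arrA_mem_homElem (p : ZMod m × Fin 3) :
    gE k m q (arrA m p) ∈ homElem k m q w (w p.2) := by
  refine gE_mem_homElem k m q w fun x => ?_
  obtain ⟨j, r⟩ := p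
  fin_cases r <;> rcases x with _ | ⟨i, s, t⟩ | ⟨i, s⟩ <;> simp [arrA, leftGen] <;>
    (try split_ifs) <;>
    first
    | exact zero_mem _
    | exact single_mem_homComp k m w (by simp [Word.deg, succ_nsmul]; try abel) _

theorem path_mem_homElem (v : Option (ZMod m)) (L : List (ZMod m × Fin 3)) :
    gE k m q (.e v) * (L.map fun p => gE k m q (arrA m p)).prod ∈
      homElem k m q w (L.map fun p => w p.2).sum := by
  rw [← zero_add (List.sum _)]
  refine mul_mem_homElem (gE_e_mem_homElem k m q w v) ?_
  induction L with
  | nil => exact one_mem_homElem k m q w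
  | cons p L ih =>
    simpa using mul_mem_homElem (gE_arrA_mem_homElem k m q w p) ih

theorem oneVec_mem_homComp : oneVec k m ∈ homComp k m w 0 :=
  add_mem (single_mem_homComp k m w rfl 1)
    (sum_mem fun i _ => single_mem_homComp k m w (by simp [Word.deg]) 1)

variable {k m q w} in
theorem coords_mem_homComp {n : M} {x : EΓ k m q} (hx : x ∈ homElem k m q w n) :
    coords k m q x ∈ homComp k m w n := by
  simpa [coords_apply] using hx 0 _ (oneVec_mem_homComp k m w)

theorem HboxA_le (l : ℕ) : HboxA k m q l ≤ homElem k m q (fun _ => 1) l := by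
  refine Submodule.span_le.2 ?_
  rintro _ ⟨v, L, rfl, rfl⟩
  simpa [SetLike.mem_coe] using path_mem_homElem k m q (fun _ => (1 : ℕ)) v L

theorem HDboxA_le_HboxA (l : ℕ) (d : ℤ) : HDboxA k m q l d ≤ HboxA k m q l :=
  Submodule.span_mono fun _ ⟨v, L, hL, _, hx⟩ => ⟨v, L, hL, hx⟩

theorem HDboxA_le (l : ℕ) (d : ℤ) : HDboxA k m q l d ≤ homElem k m q degA d := by
  refine Submodule.span_le.2 ?_
  rintro _ ⟨v, L, _, rfl, rfl⟩
  exact path_mem_homElem k m q degA v L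

theorem gE_e_mem_HboxA (v : Option (ZMod m)) : gE k m q (.e v) ∈ HboxA k m q 0 :=
  Submodule.subset_span ⟨v, [], rfl, by simp⟩

theorem gE_a_mem_HboxA (i : ZMod m) : gE k m q (.a i) ∈ HboxA k m q 1 :=
  Submodule.subset_span ⟨some i, [(i, 0)], rfl, by simp [arrA, gE_e_mul_a]⟩

theorem gE_b_mem_HboxA (i : ZMod m) : gE k m q (.b i) ∈ HboxA k m q 1 :=
  Submodule.subset_span ⟨some (i + 1), [(i, 1)], rfl, by simp [arrA, gE_e_mul_b]⟩

theorem gE_c_mem_HboxA (i : ZMod m) : gE k m q (.c i) ∈ HboxA k m q 1 :=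
  Submodule.subset_span ⟨some i, [(i, 2)], rfl, by simp [arrA, gE_e_mul_c]⟩

/-- The homogeneous elements that commute up to the Koszul sign with all homogeneous elements,
as a submonoid of `E(Γ_q)`. -/
noncomputable def gradedCentral : Submonoid (EΓ k m q) where
  carrier := {z | ∃ l : ℕ, z ∈ homElem k m q (fun _ => 1) l ∧
    ∀ (l' : ℕ) (y : EΓ k m q), y ∈ HboxA k m q l' →
      z * y = ((-1 : k) ^ (l * l')) • (y * z)}
  one_mem' := ⟨0, one_mem_homElem k m q _, fun l' y _ => by simp⟩
  mul_mem' := by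
    rintro x x' ⟨l, hx, h⟩ ⟨l', hx', h'⟩
    refine ⟨l + l', mul_mem_homElem hx hx', fun n y hy => ?_⟩
    rw [mul_assoc, h' n y hy, mul_smul_comm, ← mul_assoc, h n y hy, smul_mul_assoc, smul_smul,
      ← pow_add, mul_assoc, add_mul, add_comm]

theorem coords_comm_of_mem_ZgrA {z : EΓ k m q} (hz : z ∈ ZgrA k m q) {l' : ℕ} {y : EΓ k m q}
    (hy : y ∈ HboxA k m q l') (l : ℕ) (x : Word m) (hx : x.deg m (fun _ => 1) = l + l') :
    coords k m q (z * y) x = (-1) ^ (l * l') * coords k m q (y * z) x := by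
  have hz' : z ∈ Submodule.span k (gradedCentral k m q : Set (EΓ k m q)) := by
    rw [ZgrA, ← Subalgebra.mem_toSubmodule, Algebra.adjoin_eq_span] at hz
    refine Submodule.span_mono ?_ hz
    refine Submonoid.closure_le.2 ?_
    rintro z ⟨n, hn, h⟩
    exact ⟨n, HboxA_le k m q n hn, h⟩
  clear hz
  induction hz' using Submodule.span_induction with
  | zero => simp
  | add z z' _ _ h h' => simp [add_mul, mul_add, h, h']
  | smul c z _ h => simp [h, mul_left_comm]
  | mem z hz =>
    obtain ⟨n, hn, h⟩ := hz
    by_cases hnl : n = l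
    · rw [h l' y hy, hnl]
      simp
    · have hy' := HboxA_le k m q l' hy
      have h₁ : coords k m q (z * y) x = 0 := by
        by_contra h₀
        have := (mem_homComp _).1 (coords_mem_homComp (mul_mem_homElem hn hy')) x h₀
        omega
      have h₂ : coords k m q (y * z) x = 0 := by
        by_contra h₀
        have := (mem_homComp _).1 (coords_mem_homComp (mul_mem_homElem hy' hn)) x h₀
        omega
      rw [h₁, h₂, mul_zero]

theorem coords_mul_comm {z : EΓ k m q} (hz : z ∈ ZgrA k m q) {l l' : ℕ}
    (hzl : z ∈ HboxA k m q l) {y : EΓ k m q} (hy : y ∈ HboxA k m q l') :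
    coords k m q (z * y) = (-1 : k) ^ (l * l') • coords k m q (y * z) := by
  ext x
  by_cases hx : x.deg m (fun _ => 1) = l + l'
  · exact coords_comm_of_mem_ZgrA k m q hz hy l x hx
  · have hy' := HboxA_le k m q l' hy
    have hz' := HboxA_le k m q l hzl
    have h₁ : coords k m q (z * y) x = 0 := by
      by_contra h₀
      exact hx ((mem_homComp _).1 (coords_mem_homComp (mul_mem_homElem hz' hy')) x h₀)
    have h₂ : coords k m q (y * z) x = 0 := by
      by_contra h₀
      exact hx (((mem_homComp _).1 (coords_mem_homComp (mul_mem_homElem hy' hz')) x h₀).trans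
        (add_comm _ _))
    simp [h₁, h₂]

theorem rightOp_eq_smul_leftOp {z : EΓ k m q} (hz : z ∈ ZgrA k m q) {l l' : ℕ}
    (hzl : z ∈ HboxA k m q l) {g : GenA m} (hg : gE k m q g ∈ HboxA k m q l') :
    rightOp k m q g (coords k m q z) = (-1 : k) ^ (l * l') • leftOp k m q g (coords k m q z) := by
  rw [← coords_mul_gE, ← coords_gE_mul, coords_mul_comm k m q hz hzl hg]

end Grading

section Coefficients

variable (f : Word m →₀ k)

theorem leftOp_a_apply (j : ZMod m) (s t : ℕ) :
    leftOp k m q (.a j) f (.ab j (s + 1) t) = f (.ab (j + 1) s t) := by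
  induction f using Finsupp.induction_linear with
  | zero => simp
  | add f f' h h' => simp [h, h']
  | single x c =>
    rcases x with _ | ⟨i', s', t'⟩ | ⟨i', s'⟩ <;> simp [leftOp, leftGen, Finsupp.single_apply] <;>
      split_ifs <;> simp_all

theorem leftOp_b_apply (j : ZMod m) (s t : ℕ) :
    leftOp k m q (.b j) f (.ab (j + 1) s (t + 1)) = swapCoeff q j s * f (.ab j s t) := by
  induction f using Finsupp.induction_linear with
  | zero => simp
  | add f f' h h' => simp [h, h', mul_add]
  | single x c =>
    rcases x with _ | ⟨i', s', t'⟩ | ⟨i', s'⟩ <;> simp [leftOp, leftGen, Finsupp.single_apply] <;>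
      split_ifs <;> simp_all [mul_comm]

theorem leftOp_c_apply (j : ZMod m) (x : Word m) :
    leftOp k m q (.c j) f x = f .nil * Finsupp.single (.ac j 0) 1 x := by
  induction f using Finsupp.induction_linear with
  | zero => simp
  | add f f' h h' => simp [h, h', add_mul]
  | single y c =>
    rcases y with _ | ⟨i', s', t'⟩ | ⟨i', s'⟩ <;> simp [leftOp, leftGen, Finsupp.single_apply]

theorem leftOp_e_apply_ab (i : ZMod m) (s t : ℕ) :
    leftOp k m q (.e (some i)) f (.ab i s t) = f (.ab i s t) := by
  induction f using Finsupp.induction_linear with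
  | zero => simp
  | add f f' h h' => simp [h, h']
  | single x c =>
    rcases x with _ | ⟨i', s', t'⟩ | ⟨i', s'⟩ <;> simp [leftOp, leftGen, Finsupp.single_apply] <;>
      split_ifs <;> simp_all

theorem leftOp_e_apply_ac (i : ZMod m) (s : ℕ) :
    leftOp k m q (.e (some i)) f (.ac i s) = f (.ac i s) := by
  induction f using Finsupp.induction_linear with
  | zero => simp
  | add f f' h h' => simp [h, h']
  | single x c =>
    rcases x with _ | ⟨i', s', t'⟩ | ⟨i', s'⟩ <;> simp [leftOp, leftGen, Finsupp.single_apply] <;>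
      split_ifs <;> simp_all

theorem rightOp_a_apply (i : ZMod m) (s t : ℕ) :
    rightOp k m q (.a (i + s - t)) f (.ab i (s + 1) t) =
      swapCoeff q (i + s - t) t * f (.ab i s t) := by
  induction f using Finsupp.induction_linear with
  | zero => simp
  | add f f' h h' => simp [h, h', mul_add]
  | single x c =>
    by_cases hx : x = .ab i s t
    · simp [hx, rightOp, rightGen, mul_comm]
    rcases x with _ | ⟨i', s', t'⟩ | ⟨i', s'⟩ <;> simp [rightOp, rightGen, hx] <;>
      split_ifs <;> simp_all

theorem rightOp_b_apply (i : ZMod m) (s t : ℕ) :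
    rightOp k m q (.b (i + s - t - 1)) f (.ab i s (t + 1)) = f (.ab i s t) := by
  induction f using Finsupp.induction_linear with
  | zero => simp
  | add f f' h h' => simp [h, h']
  | single x c =>
    by_cases hx : x = .ab i s t
    · simp [hx, rightOp, rightGen]
    rcases x with _ | ⟨i', s', t'⟩ | ⟨i', s'⟩ <;> simp [rightOp, rightGen, hx] <;>
      split_ifs <;> simp_all

theorem rightOp_c_apply (i : ZMod m) (s : ℕ) :
    rightOp k m q (.c (i + s)) f (.ac i s) = f (.ab i s 0) := by
  induction f using Finsupp.induction_linear with
  | zero => simp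
  | add f f' h h' => simp [h, h']
  | single x c =>
    by_cases hx : x = .ab i s 0
    · simp [hx, rightOp, rightGen]
    rcases x with _ | ⟨i', s', _ | t'⟩ | ⟨i', s'⟩ <;> simp [rightOp, rightGen, hx] <;>
      split_ifs <;> simp_all

theorem rightOp_e_apply_ab {i : ZMod m} {s t : ℕ} (h : (s : ZMod m) ≠ t) :
    rightOp k m q (.e (some i)) f (.ab i s t) = 0 := by
  have hi : ¬ i + s - t = i := fun h' => h (by linear_combination h')
  induction f using Finsupp.induction_linear with
  | zero => simp
  | add f f' h h' => simp [h, h']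
  | single x c =>
    rcases x with _ | ⟨i', s', t'⟩ | ⟨i', s'⟩ <;> simp [rightOp, rightGen] <;>
      split_ifs <;> simp [Finsupp.single_apply]
    grind

theorem rightOp_e_apply_ac (i : ZMod m) (s : ℕ) :
    rightOp k m q (.e (some i)) f (.ac i s) = 0 := by
  induction f using Finsupp.induction_linear with
  | zero => simp
  | add f f' h h' => simp [h, h']
  | single x c =>
    rcases x with _ | ⟨i', s', t'⟩ | ⟨i', s'⟩ <;> simp [rightOp, rightGen] <;>
      split_ifs <;> simp

end Coefficients

variable {k m q} in
/-- A graded-central element has no coordinates at the paths ending in `c`, and is supported on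
closed paths. -/
theorem closed_of_coords_ne_zero {z : EΓ k m q} (hz : z ∈ ZgrA k m q) {l : ℕ}
    (hzl : z ∈ HboxA k m q l) {x : Word m} (hx : coords k m q z x ≠ 0) :
    x = .nil ∨ ∃ (i : ZMod m) (s t : ℕ), x = .ab i s t ∧ (s : ZMod m) = t := by
  have he (i : ZMod m) := rightOp_eq_smul_leftOp k m q hz hzl (gE_e_mem_HboxA k m q (some i))
  simp only [mul_zero, pow_zero, one_smul] at he
  rcases x with _ | ⟨i, s, t⟩ | ⟨i, s⟩
  · exact .inl rfl
  · refine .inr ⟨i, s, t, rfl, ?_⟩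
    by_contra h
    have := DFunLike.congr_fun (he i) (.ab i s t)
    rw [rightOp_e_apply_ab k m q _ h, leftOp_e_apply_ab] at this
    exact hx this.symm
  · have := DFunLike.congr_fun (he i) (.ac i s)
    rw [rightOp_e_apply_ac, leftOp_e_apply_ac] at this
    exact absurd this.symm hx

variable {k m q} in
theorem eq_algebraMap_of_length_zero {z : EΓ k m q} (hz : z ∈ ZgrA k m q)
    (hzl : z ∈ HboxA k m q 0) : z = algebraMap k (EΓ k m q) (coords k m q z .nil) := by
  have hc (i : ZMod m) : coords k m q z (.ab i 0 0) = coords k m q z .nil := by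
    have := DFunLike.congr_fun
      (rightOp_eq_smul_leftOp k m q hz hzl (gE_c_mem_HboxA k m q (i + (0 : ℕ)))) (.ac i 0)
    rw [rightOp_c_apply] at this
    simpa [leftOp_c_apply] using this
  have hsupp := (mem_homComp _).1 (coords_mem_homComp (HboxA_le k m q 0 hzl))
  have key : coords k m q z = coords k m q z .nil • oneVec k m := by
    ext x
    rcases x with _ | ⟨i, s, t⟩ | ⟨i, s⟩
    · simp [oneVec]
    · by_cases hst : s = 0 ∧ t = 0
      · obtain ⟨rfl, rfl⟩ := hst
        simp [oneVec, hc, Finsupp.single_apply]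
      · have h₀ : coords k m q z (.ab i s t) = 0 := by
          by_contra h
          have := hsupp _ h
          simp [Word.deg] at this
          exact hst this
        rw [h₀]
        have hst' : ¬(0 = s ∧ 0 = t) := fun h => hst ⟨h.1.symm, h.2.symm⟩
        simp [oneVec, hst']
    · have h₀ : coords k m q z (.ac i s) = 0 := by
        by_contra h
        simpa [Word.deg] using hsupp _ h
      rw [h₀]
      simp [oneVec]
  conv_lhs => rw [← ofCoords_coords k m q z, key, map_smul, ofCoords_oneVec]
  rw [Algebra.algebraMap_eq_smul_one]

variable {k m q} in
theorem one_le_of_coords_ne_zero {z : EΓ k m q} (hz : z ∈ ZgrA k m q) {l : ℕ}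
    (hzl : z ∈ HboxA k m q l) (hl : l ≠ 0) {i : ZMod m} {s t : ℕ}
    (hx : coords k m q z (.ab i s t) ≠ 0) : 1 ≤ t := by
  have hsupp := (mem_homComp _).1 (coords_mem_homComp (HboxA_le k m q l hzl))
  by_contra ht
  obtain rfl : t = 0 := by omega
  have := DFunLike.congr_fun
    (rightOp_eq_smul_leftOp k m q hz hzl (gE_c_mem_HboxA k m q (i + s))) (.ac i s)
  have hnil : coords k m q z .nil = 0 := by
    by_contra h
    exact hl (hsupp _ h).symm
  rw [rightOp_c_apply, Finsupp.smul_apply, leftOp_c_apply, hnil] at this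
  exact hx (by simpa using this)

variable {k m q} in
theorem coords_succ_eq {z : EΓ k m q} (hz : z ∈ ZgrA k m q) {s t : ℕ}
    (hzl : z ∈ HboxA k m q (s + t)) (hst : (s : ZMod m) = t) (j : ZMod m) :
    coords k m q z (.ab (j + 1) s t) = (-1) ^ s *
        (∏ r ∈ Finset.range t, q (j + 1 + (r : ZMod m)))⁻¹ * coords k m q z (.ab j s t) ∧
      coords k m q z (.ab (j + 1) s t) = (-1) ^ t *
        (∏ r ∈ Finset.range s, q (j + 1 + (r : ZMod m)))⁻¹ * coords k m q z (.ab j s t) := by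
  have hsq (n : ℕ) : ((-1 : k) ^ n) * (-1) ^ n = 1 := by rw [← mul_pow]; simp
  constructor
  · have := DFunLike.congr_fun
      (rightOp_eq_smul_leftOp k m q hz hzl (gE_a_mem_HboxA k m q (j + s - t))) (.ab j (s + 1) t)
    rw [rightOp_a_apply, hst, add_sub_cancel_right, Finsupp.smul_apply, leftOp_a_apply,
      swapCoeff_eq, mul_one, pow_add, smul_eq_mul] at this
    linear_combination (-(-1) ^ s * (-1) ^ t) * this -
      coords k m q z (.ab (j + 1) s t) * (-1) ^ t * (-1) ^ t * hsq s -
      coords k m q z (.ab (j + 1) s t) * hsq t + (-1) ^ s *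
        (∏ r ∈ Finset.range t, q (j + 1 + (r : ZMod m)))⁻¹ * coords k m q z (.ab j s t) * hsq t
  · have := DFunLike.congr_fun
      (rightOp_eq_smul_leftOp k m q hz hzl (gE_b_mem_HboxA k m q (j + 1 + s - t - 1)))
      (.ab (j + 1) s (t + 1))
    rw [rightOp_b_apply, hst, add_sub_cancel_right, add_sub_cancel_right, Finsupp.smul_apply,
      leftOp_b_apply, swapCoeff_eq, mul_one, pow_add, smul_eq_mul] at this
    linear_combination this + (-1) ^ t *
      (∏ r ∈ Finset.range s, q (j + 1 + (r : ZMod m)))⁻¹ * coords k m q z (.ab j s t) * hsq s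

theorem eval_ab_of_cast_eq (i : ZMod m) {s t : ℕ} (ht : 1 ≤ t) (hst : (s : ZMod m) = t) :
    (Word.ab i s t).eval k m q = γA k m q i s * δA k m q i t := by
  rw [Word.eval, hst, add_sub_cancel_right]
  refine gE_e_mul_γA_mul k m q s ?_
  obtain ⟨t, rfl⟩ := Nat.exists_eq_add_of_le' ht
  rw [δA_succ, hst, Nat.cast_add, Nat.cast_one, ← mul_assoc, ← add_assoc, gE_e_mul_b]

variable {k m q} in
theorem eq_sum_of_coords_support {z : EΓ k m q} {s t : ℕ} (ht : 1 ≤ t) (hst : (s : ZMod m) = t)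
    (h : ∀ x, coords k m q z x ≠ 0 → ∃ i, x = .ab i s t) :
    z = ∑ i : ZMod m, coords k m q z (.ab i s t) • (γA k m q i s * δA k m q i t) := by
  have key : coords k m q z =
      ∑ i : ZMod m, Finsupp.single (.ab i s t) (coords k m q z (.ab i s t)) := by
    ext x
    by_cases hx : ∃ i, x = .ab i s t
    · obtain ⟨i, rfl⟩ := hx
      simp [Finsupp.single_apply]
    · rw [not_imp_comm.1 (h x) hx, Finsupp.finsetSum_apply]
      refine (Finset.sum_eq_zero fun i _ => ?_).symm
      exact Finsupp.single_eq_of_ne fun h' => hx ⟨i, h'⟩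
  conv_lhs => rw [← ofCoords_coords k m q z, key]
  simp [ofCoords, eval_ab_of_cast_eq k m q _ ht hst]

end KoszulDual

/-- Lemma 2.1.  Let `z ∈ Z_gr(E(Γ_q))` be homogeneous both with respect to
path length and with respect to the `(a, c ↦ +1, b ↦ −1)`-degree.  Then either `z` is a scalar
in `k`, or there exist integers `s₀ ≥ 0` and `t₀ ≥ 1` with `s₀ ≡ t₀ (mod m)` and scalars
`u₀, …, u_{m−1} ∈ k` such that `z = Σ_{i=0}^{m−1} u_i γ_i^{s₀} δ_i^{t₀}`, where for all
`0 ≤ j ≤ m−1` (subscripts of `u` and `q` mod `m`, `u_m = u₀`):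
`u_{j+1} = (−1)^{s₀} (q_{j+1} ⋯ q_{j+t₀})⁻¹ u_j = (−1)^{t₀} (q_{j+1} ⋯ q_{j+s₀})⁻¹ u_j`. -/
theorem stmt_0 (k : Type) [Field k] (m : ℕ) [NeZero m] (hm : 2 ≤ m)
    (q : ZMod m → k) (hq : ∀ i, q i ≠ 0)
    (z : EΓ k m q) (hzZ : z ∈ ZgrA k m q)
    (l : ℕ) (d : ℤ) (hz : z ∈ HDboxA k m q l d) :
    (∃ c : k, z = algebraMap k (EΓ k m q) c) ∨
    (∃ (s₀ t₀ : ℕ) (u : ZMod m → k), 1 ≤ t₀ ∧ (s₀ : ZMod m) = (t₀ : ZMod m) ∧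
      z = ∑ i : ZMod m, u i • (γA k m q i s₀ * δA k m q i t₀) ∧
      ∀ j : ZMod m,
        u (j + 1) = (-1 : k) ^ s₀ * (∏ l' ∈ Finset.range t₀, q (j + 1 + (l' : ZMod m)))⁻¹ * u j ∧
        u (j + 1) = (-1 : k) ^ t₀ * (∏ l' ∈ Finset.range s₀, q (j + 1 + (l' : ZMod m)))⁻¹ * u j) := by
  have hzl := KoszulDual.HDboxA_le_HboxA k m q l d hz
  obtain rfl | hl := eq_or_ne l 0
  · exact .inl ⟨_, KoszulDual.eq_algebraMap_of_length_zero hzZ hzl⟩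
  by_cases hz₀ : KoszulDual.coords k m q z = 0
  · refine .inl ⟨0, ?_⟩
    rw [← KoszulDual.ofCoords_coords k m q z, hz₀, map_zero, map_zero]
  have hdeg (x) (hx : KoszulDual.coords k m q z x ≠ 0) :
      ∃ (i : ZMod m) (s t : ℕ), x = .ab i s t ∧ (s : ZMod m) = t ∧ s + t = l ∧ (s - t : ℤ) = d := by
    have h₁ := (KoszulDual.mem_homComp _).1
      (KoszulDual.coords_mem_homComp (KoszulDual.HboxA_le k m q l hzl)) x hx
    have h₂ := (KoszulDual.mem_homComp _).1
      (KoszulDual.coords_mem_homComp (KoszulDual.HDboxA_le k m q l d hz)) x hx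
    obtain rfl | ⟨i, s, t, rfl, hst⟩ := KoszulDual.closed_of_coords_ne_zero hzZ hzl hx
    · exact absurd h₁.symm hl
    · refine ⟨i, s, t, rfl, hst, by simpa [KoszulDual.Word.deg] using h₁, ?_⟩
      simpa [KoszulDual.Word.deg, degA, sub_eq_add_neg] using h₂
  obtain ⟨x, hx⟩ := DFunLike.ne_iff.1 hz₀
  obtain ⟨i, s, t, rfl, hst, rfl, rfl⟩ := hdeg x hx
  have ht := KoszulDual.one_le_of_coords_ne_zero hzZ hzl hl hx
  refine .inr ⟨s, t, fun i => KoszulDual.coords k m q z (.ab i s t), ht, hst,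
    KoszulDual.eq_sum_of_coords_support ht hst fun y hy => ?_,
    KoszulDual.coords_succ_eq hzZ hzl hst⟩
  obtain ⟨i', s', t', rfl, -, h₁, h₂⟩ := hdeg y hy
  obtain rfl : s' = s := by omega
  obtain rfl : t' = t := by omega
  exact ⟨i', rfl⟩
end

section
/- Let ζ = q₀q₁⋯q_{m−1}. Suppose s₀, t₀ are nonnegative integers and u₀, u₁, …, u_{m−1} ∈ k with u₀ ≠ 0 satisfy (setting u_m = u₀ and taking all subscripts of q modulo m) u_{j+1} = (−1)^{s₀}(q_{j+1}q_{j+2}⋯q_{j+t₀})^{−1} u_j and u_{j+1} = (−1)^{t₀}(q_{j+1}q_{j+2}⋯q_{j+s₀})^{−1} u_j for all 0 ≤ j ≤ m−1. Then u_i = (−1)^{i s₀} Π_{k=1}^{i}(q_k q_{k+1}⋯q_{k+t₀−1})^{−1} u₀ for i = 1,…,m−1, and moreover ζ^{t₀} = (−1)^{m s₀} and ζ^{s₀} = (−1)^{m t₀}. -/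
theorem prod_range_natCast_zmod {M : Type*} [CommMonoid M] (m : ℕ) [NeZero m]
    (f : ZMod m → M) : ∏ i ∈ Finset.range m, f (i : ZMod m) = ∏ x : ZMod m, f x := by
  refine Finset.prod_bij' (fun i _ => (i : ZMod m)) (fun x _ => x.val) ?_ ?_ ?_ ?_ ?_
  · simp
  · intro x _
    exact Finset.mem_range.mpr (ZMod.val_lt x)
  · intro i hi
    exact ZMod.val_cast_of_lt (Finset.mem_range.mp hi)
  · intro x _
    exact ZMod.natCast_zmod_val x
  · simp

section CyclicRecursion

variable {k : Type*} [Field k] {m : ℕ} {q u : ZMod m → k} {s t : ℕ}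

/-- Closed form of a solution of the recursion `u_{j+1} = (-1)^s (q_{j+1} ⋯ q_{j+t})⁻¹ u_j`. -/
theorem cyclic_recursion_closed_form
    (hrec : ∀ j : ZMod m,
      u (j + 1) = (-1 : k) ^ s * (∏ l ∈ Finset.range t, q (j + 1 + (l : ZMod m)))⁻¹ * u j)
    (i : ℕ) :
    u (i : ZMod m) = (-1 : k) ^ (i * s) *
      (∏ k' ∈ Finset.range i,
        (∏ l ∈ Finset.range t, q (((k' + 1 : ℕ) : ZMod m) + (l : ZMod m)))⁻¹) * u 0 := by
  induction i with
  | zero => simp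
  | succ i ih =>
    rw [Finset.prod_range_succ, Nat.cast_succ, hrec, ih]
    ring

/-- The periodicity constraint on the parameters of a nonzero solution. -/
theorem cyclic_recursion_prod_pow [NeZero m] (hq : ∀ i, q i ≠ 0) (hu0 : u 0 ≠ 0)
    (hrec : ∀ j : ZMod m,
      u (j + 1) = (-1 : k) ^ s * (∏ l ∈ Finset.range t, q (j + 1 + (l : ZMod m)))⁻¹ * u j) :
    (∏ i ∈ Finset.range m, q (i : ZMod m)) ^ t = (-1 : k) ^ (m * s) := by
  have hprod : ∏ k' ∈ Finset.range m,
      ∏ l ∈ Finset.range t, q (((k' + 1 : ℕ) : ZMod m) + (l : ZMod m)) =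
      (∏ i ∈ Finset.range m, q (i : ZMod m)) ^ t := by
    rw [Finset.prod_comm, prod_range_natCast_zmod m q, Finset.prod_eq_pow_card (b := ∏ x, q x),
      Finset.card_range]
    intro l _
    push_cast
    rw [prod_range_natCast_zmod m fun x => q (x + 1 + (l : ZMod m))]
    simp_rw [add_assoc]
    exact Equiv.prod_comp (Equiv.addRight (1 + (l : ZMod m))) q
  have hne : (∏ i ∈ Finset.range m, q (i : ZMod m)) ^ t ≠ 0 :=
    pow_ne_zero _ (Finset.prod_ne_zero_iff.mpr fun i _ => hq i)
  have hclosed := cyclic_recursion_closed_form hrec m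
  rw [Finset.prod_inv_distrib, hprod, ZMod.natCast_self] at hclosed
  have hone := mul_right_cancel₀ hu0 ((one_mul (u 0)).trans hclosed)
  rwa [eq_mul_inv_iff_mul_eq₀ hne, one_mul] at hone

end CyclicRecursion

/-- Let `k` be a field, `m ≥ 2`, and `q₀, …, q_{m−1} ∈ k^*` with subscripts
taken modulo `m`.  Suppose `s₀, t₀` are nonnegative integers and `u₀, …, u_{m−1} ∈ k` with
`u₀ ≠ 0` satisfy (with `u_m = u₀`, all subscripts of `q` mod `m`)
`u_{j+1} = (−1)^{s₀} (q_{j+1} ⋯ q_{j+t₀})⁻¹ u_j` and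
`u_{j+1} = (−1)^{t₀} (q_{j+1} ⋯ q_{j+s₀})⁻¹ u_j` for all `0 ≤ j ≤ m−1`.
Then `u_i = (−1)^{i s₀} ∏_{k=1}^{i} (q_k ⋯ q_{k+t₀−1})⁻¹ u₀` for `i = 1, …, m−1`, and
with `ζ = q₀ q₁ ⋯ q_{m−1}` we have `ζ^{t₀} = (−1)^{m s₀}` and `ζ^{s₀} = (−1)^{m t₀}`. -/
theorem stmt_1 (k : Type*) [Field k] (m : ℕ) [NeZero m] (hm : 2 ≤ m)
    (q : ZMod m → k) (hq : ∀ i, q i ≠ 0)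
    (s₀ t₀ : ℕ) (u : ZMod m → k) (hu0 : u 0 ≠ 0)
    (hrec1 : ∀ j : ZMod m,
      u (j + 1) = (-1 : k) ^ s₀ * (∏ l ∈ Finset.range t₀, q (j + 1 + (l : ZMod m)))⁻¹ * u j)
    (hrec2 : ∀ j : ZMod m,
      u (j + 1) = (-1 : k) ^ t₀ * (∏ l ∈ Finset.range s₀, q (j + 1 + (l : ZMod m)))⁻¹ * u j) :
    (∀ i : ℕ, 1 ≤ i → i ≤ m - 1 →
      u (i : ZMod m) = (-1 : k) ^ (i * s₀) *
        (∏ k' ∈ Finset.range i,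
          (∏ l ∈ Finset.range t₀, q (((k' + 1 : ℕ) : ZMod m) + (l : ZMod m)))⁻¹) * u 0)
    ∧ (∏ i ∈ Finset.range m, q (i : ZMod m)) ^ t₀ = (-1 : k) ^ (m * s₀)
    ∧ (∏ i ∈ Finset.range m, q (i : ZMod m)) ^ s₀ = (-1 : k) ^ (m * t₀) := by
  exact ⟨fun i _ _ => cyclic_recursion_closed_form hrec1 i,
    cyclic_recursion_prod_pow hq hu0 hrec1, cyclic_recursion_prod_pow hq hu0 hrec2⟩
end

section
/- Let k be a field, p ≥ 1 an integer, and ε ∈ k^*. Let A = (k[x,y,w]/⟨w^p − ε x y⟩)_{x*} be the k-subspace of the commutative ring k[x,y,w]/⟨w^p − ε x y⟩ spanned by the images of all monomials in x, y, w except the pure powers x^i for i ≥ 1. Then A is a k-subalgebra, the element x^i y lies in A for every i ≥ 1 while x^i does not lie in A for any i ≥ 1, and A is not finitely generated as a k-algebra. -/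
open MvPolynomial

/-- The commutative ring `k[x,y,w]/⟨w^p − ε x y⟩`. -/
abbrev Quot5 (k : Type*) [Field k] (p : ℕ) (ε : k) : Type _ :=
  MvPolynomial (Fin 3) k ⧸
    Ideal.span {(X 2 : MvPolynomial (Fin 3) k) ^ p - C ε * X 0 * X 1}

/-- The `k`-subspace `(k[x,y,w]/⟨w^p − ε x y⟩)_{x*}` spanned by the images of all monomials
`x^i y^j w^l` except the pure powers `x^i`, `i ≥ 1`. -/
noncomputable def A5 (k : Type*) [Field k] (p : ℕ) (ε : k) : Submodule k (Quot5 k p ε) :=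
  Submodule.span k
    {z | ∃ i j l : ℕ, (i = 0 ∨ 0 < j + l) ∧
      z = Ideal.Quotient.mk _ ((X 0 : MvPolynomial (Fin 3) k) ^ i * X 1 ^ j * X 2 ^ l)}

/-- The subalgebra of `k[X][δ]` of elements `c + v δ` with `c` constant and `v` of degree
less than `n`. -/
def constAddDegreeLT (k : Type*) [Field k] (n : ℕ) : Subalgebra k (DualNumber (Polynomial k)) where
  carrier := {u | (∃ c, u.fst = Polynomial.C c) ∧ u.snd ∈ Polynomial.degreeLT k n}
  mul_mem' := by
    rintro a b ⟨⟨c, hc⟩, ha⟩ ⟨⟨d, hd⟩, hb⟩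
    refine ⟨⟨c * d, by simp [hc, hd]⟩, ?_⟩
    rw [TrivSqZeroExt.snd_mul, hc, hd]
    simpa [← Polynomial.smul_eq_C_mul, ← Polynomial.C_mul', mul_comm] using
      add_mem (Submodule.smul_mem _ c hb) (Submodule.smul_mem _ d ha)
  add_mem' := by
    rintro a b ⟨⟨c, hc⟩, ha⟩ ⟨⟨d, hd⟩, hb⟩
    exact ⟨⟨c + d, by simp [hc, hd]⟩, add_mem ha hb⟩
  algebraMap_mem' r := ⟨⟨r, rfl⟩, zero_mem _⟩

/-- A first-order deformation of the quotient map `k[x,y,w]/⟨w^p − ε x y⟩ → k[x]` that is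
nontrivial in the direction of `y` or of `w`. -/
theorem exists_algHom_dualNumber (k : Type*) [Field k] (p : ℕ) (hp : 1 ≤ p) (ε : k) :
    ∃ f : Quot5 k p ε →ₐ[k] DualNumber (Polynomial k),
      f (Ideal.Quotient.mk _ (X 0)) = TrivSqZeroExt.inl Polynomial.X ∧
      (f (Ideal.Quotient.mk _ (X 1))).fst = 0 ∧ (f (Ideal.Quotient.mk _ (X 2))).fst = 0 ∧
      ∃ j l : ℕ, 0 < j + l ∧ f (Ideal.Quotient.mk _ (X 1 ^ j * X 2 ^ l)) = DualNumber.eps := by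
  have lift (y w : DualNumber (Polynomial k))
      (h : w ^ p = algebraMap k _ ε * TrivSqZeroExt.inl Polynomial.X * y) :
      ∃ f : Quot5 k p ε →ₐ[k] DualNumber (Polynomial k),
        f (Ideal.Quotient.mk _ (X 0)) = TrivSqZeroExt.inl Polynomial.X ∧
        f (Ideal.Quotient.mk _ (X 1)) = y ∧ f (Ideal.Quotient.mk _ (X 2)) = w := by
    refine ⟨Ideal.Quotient.liftₐ _ (aeval ![TrivSqZeroExt.inl Polynomial.X, y, w]) ?_,
      ?_, ?_, ?_⟩
    · intro a ha
      obtain ⟨b, rfl⟩ := Ideal.mem_span_singleton'.1 ha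
      simp [h]
    all_goals
      rw [← Ideal.Quotient.mkₐ_eq_mk k, ← AlgHom.comp_apply, Ideal.Quotient.liftₐ_comp]
      simp
  obtain rfl | hp2 := hp.eq_or_lt
  · obtain ⟨f, hx, hy, hw⟩ := lift DualNumber.eps
      (algebraMap k _ ε * TrivSqZeroExt.inl Polynomial.X * DualNumber.eps) (pow_one _)
    exact ⟨f, hx, by simp [hy], by simp [hw], 1, 0, by simp, by simp [hy]⟩
  · obtain ⟨f, hx, hy, hw⟩ := lift 0 DualNumber.eps (by
      rw [mul_zero]
      exact pow_eq_zero_of_le hp2 (by rw [pow_two, DualNumber.eps_mul_eps]))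
    exact ⟨f, hx, by simp [hy], by simp [hw], 0, 1, by simp, by simp [hw]⟩

theorem A5_mul_mem {k : Type*} [Field k] {p : ℕ} {ε : k} {a b : Quot5 k p ε}
    (ha : a ∈ A5 k p ε) (hb : b ∈ A5 k p ε) : a * b ∈ A5 k p ε := by
  refine (Submodule.span_mul_span k _ _).le.trans (Submodule.span_mono ?_)
    (Submodule.mul_mem_mul ha hb)
  rintro _ ⟨_, ⟨i, j, l, h, rfl⟩, _, ⟨i', j', l', h', rfl⟩, rfl⟩
  refine ⟨i + i', j + j', l + l', by omega, ?_⟩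
  simp only [← map_mul]
  congr 1
  ring

theorem fst_eq_C_of_mem_A5 {k : Type*} [Field k] {p : ℕ} {ε : k}
    {f : Quot5 k p ε →ₐ[k] DualNumber (Polynomial k)}
    (hy : (f (Ideal.Quotient.mk _ (X 1))).fst = 0) (hw : (f (Ideal.Quotient.mk _ (X 2))).fst = 0)
    {a : Quot5 k p ε} (ha : a ∈ A5 k p ε) : ∃ c, (f a).fst = Polynomial.C c := by
  induction ha using Submodule.span_induction with
  | mem a ha =>
    obtain ⟨i, j, l, h, rfl⟩ := ha
    rcases Nat.eq_zero_or_pos (j + l) with h0 | h0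
    · obtain ⟨rfl, rfl⟩ : j = 0 ∧ l = 0 := by omega
      obtain rfl : i = 0 := by omega
      exact ⟨1, by simp⟩
    · refine ⟨0, ?_⟩
      rcases Nat.eq_zero_or_pos j with rfl | hj
      · simp [hw, show l ≠ 0 by omega]
      · simp [hy, hj.ne']
  | zero => exact ⟨0, by simp⟩
  | add a b _ _ ha hb =>
    obtain ⟨c, hc⟩ := ha
    obtain ⟨d, hd⟩ := hb
    exact ⟨c + d, by simp [hc, hd]⟩
  | smul r a _ ha =>
    obtain ⟨c, hc⟩ := ha
    exact ⟨r * c, by simp [hc, Polynomial.smul_eq_C_mul]⟩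

/-- **Statement 5.**  Let `k` be a field, `p ≥ 1`, and `ε ∈ k^*`.  Let
`A = (k[x,y,w]/⟨w^p − ε x y⟩)_{x*}` be the `k`-subspace of `k[x,y,w]/⟨w^p − ε x y⟩` spanned
by the images of all monomials in `x, y, w` except the pure powers `x^i` for `i ≥ 1`.
Then `A` is a `k`-subalgebra, the element `x^i y` lies in `A` for every `i ≥ 1` while `x^i`
does not lie in `A` for any `i ≥ 1`, and `A` is not finitely generated as a `k`-algebra. -/
theorem stmt_5 (k : Type*) [Field k] (p : ℕ) (hp : 1 ≤ p) (ε : k) (hε : ε ≠ 0) :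
    ((1 : Quot5 k p ε) ∈ A5 k p ε ∧
      ∀ a b : Quot5 k p ε, a ∈ A5 k p ε → b ∈ A5 k p ε → a * b ∈ A5 k p ε) ∧
    (∀ i : ℕ, 1 ≤ i →
      (Ideal.Quotient.mk _ ((X 0 : MvPolynomial (Fin 3) k) ^ i * X 1) ∈ A5 k p ε ∧
        Ideal.Quotient.mk _ ((X 0 : MvPolynomial (Fin 3) k) ^ i) ∉ A5 k p ε)) ∧
    ¬ ∃ s : Finset (Quot5 k p ε), (↑s : Set (Quot5 k p ε)) ⊆ (A5 k p ε : Set (Quot5 k p ε)) ∧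
        (A5 k p ε : Set (Quot5 k p ε)) ⊆
          (Algebra.adjoin k (↑s : Set (Quot5 k p ε)) : Subalgebra k (Quot5 k p ε)) := by
  obtain ⟨f, hx, hy, hw, j, l, hjl, he⟩ := exists_algHom_dualNumber k p hp ε
  refine ⟨⟨Submodule.subset_span ⟨0, 0, 0, Or.inl rfl, by simp⟩, fun a b => A5_mul_mem⟩,
    fun i hi => ⟨Submodule.subset_span ⟨i, 1, 0, by simp, by simp⟩, fun h => ?_⟩, ?_⟩
  · obtain ⟨c, hc⟩ := fst_eq_C_of_mem_A5 hy hw h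
    rw [map_pow, map_pow, hx, TrivSqZeroExt.fst_pow, TrivSqZeroExt.fst_inl] at hc
    have := congrArg Polynomial.natDegree hc
    rw [Polynomial.natDegree_X_pow, Polynomial.natDegree_C] at this
    omega
  · rintro ⟨s, hs, hA⟩
    let n := s.sup (fun a => (f a).snd.natDegree) + 1
    have hle : Algebra.adjoin k (s : Set (Quot5 k p ε)) ≤ (constAddDegreeLT k n).comap f := by
      refine Algebra.adjoin_le fun a ha => ⟨fst_eq_C_of_mem_A5 hy hw (hs ha), ?_⟩
      refine Polynomial.mem_degreeLT.2 (Polynomial.degree_le_natDegree.trans_lt ?_)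
      exact_mod_cast Nat.lt_succ_of_le (Finset.le_sup (f := fun a => (f a).snd.natDegree) ha)
    have hf : f (Ideal.Quotient.mk _ (X 0 ^ n * (X 1 ^ j * X 2 ^ l))) =
        TrivSqZeroExt.inl Polynomial.X ^ n * DualNumber.eps := by
      rw [map_mul, map_mul, he, map_pow, map_pow, hx]
    have hmem : (f (Ideal.Quotient.mk _ (X 0 ^ n * (X 1 ^ j * X 2 ^ l)))).snd ∈
        Polynomial.degreeLT k n :=
      (hle (hA (Submodule.subset_span ⟨n, j, l, Or.inr hjl, congrArg _ (mul_assoc _ _ _).symm⟩))).2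
    rw [hf] at hmem
    simp [Polynomial.mem_degreeLT] at hmem
end
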